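/- Let (M,ρ) be a pseudometric space and let X = ℝ² equipped with the sup norm ‖(x1,x2)‖ = max{|x1|, |x2|} (the space ℓ∞²). Let F assign to each x ∈ M a nonempty compact convex subset F(x) ⊆ X, and assume that for every subset M' ⊆ M with at most 4 points there is a selection f : M' → X with ‖f(x) − f(y)‖ ≤ ρ(x,y) on M'. Let λ1 ≥ 1, λ2 ≥ 3λ1, and γ ≥ λ2·(3λ2+λ1)/(λ2−λ1). Then for every x ∈ M the second balanced refinement F²(x) is nonempty, and d_H(F²(x), F²(y)) ≤ γ·ρ(x,y) for all x,y ∈ M. In particular, one can take λ1 = 1, λ2 = 3, γ = 15. -/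

import Mathlib

open Pointwise Metric

/-- Hausdorff distance between subsets of a normed space, defined via Minkowski
sums with closed balls. -/
noncomputable def hausDistB {X : Type*} [NormedAddCommGroup X] (A B : Set X) : ℝ :=
  sInf {r : ℝ | 0 < r ∧ A ⊆ B + closedBall (0 : X) r ∧ B ⊆ A + closedBall (0 : X) r}


lemma aux_helly4 (F : Fin 4 → Set (Fin 2 → ℝ)) (hc : ∀ m, Convex ℝ (F m))
    (h : ∀ m, ∃ q, ∀ n, n ≠ m → q ∈ F n) : ∃ q, ∀ n, q ∈ F n := by
  have := Convex.helly_theorem' (𝕜 := ℝ) (F := F) (s := Finset.univ) (fun i _ => hc i) (by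
    intro I _ hI
    have hI' : I.card ≤ 3 := by simpa using hI
    have : ∃ m, m ∉ I := by
      by_contra hcon
      push Not at hcon
      have : I = Finset.univ := Finset.eq_univ_of_forall hcon
      rw [this] at hI'
      simp at hI'
    obtain ⟨m, hm⟩ := this
    obtain ⟨q, hq⟩ := h m
    refine ⟨q, ?_⟩
    simp only [Set.mem_iInter]
    intro n hn
    exact hq n (fun e => hm (e ▸ hn)))
  obtain ⟨q, hq⟩ := this
  refine ⟨q, fun n => ?_⟩
  simp only [Set.mem_iInter] at hq
  exact hq n (Finset.mem_univ n)

lemma aux_four {A B C D : Set (Fin 2 → ℝ)} (hA : Convex ℝ A) (hB : Convex ℝ B) (hC : Convex ℝ C)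
    (hD : Convex ℝ D) (h1 : ∃ q, q ∈ B ∧ q ∈ C ∧ q ∈ D) (h2 : ∃ q, q ∈ A ∧ q ∈ C ∧ q ∈ D)
    (h3 : ∃ q, q ∈ A ∧ q ∈ B ∧ q ∈ D) (h4 : ∃ q, q ∈ A ∧ q ∈ B ∧ q ∈ C) :
    ∃ q, q ∈ A ∧ q ∈ B ∧ q ∈ C ∧ q ∈ D := by
  obtain ⟨q, hq⟩ := aux_helly4 ![A, B, C, D] (by
    intro m; fin_cases m <;> simpa) (by
    intro m
    fin_cases m
    · obtain ⟨q, a, b, c⟩ := h1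
      refine ⟨q, fun n hn => ?_⟩
      fin_cases n <;> simp_all
    · obtain ⟨q, a, b, c⟩ := h2
      refine ⟨q, fun n hn => ?_⟩
      fin_cases n <;> simp_all
    · obtain ⟨q, a, b, c⟩ := h3
      refine ⟨q, fun n hn => ?_⟩
      fin_cases n <;> simp_all
    · obtain ⟨q, a, b, c⟩ := h4
      refine ⟨q, fun n hn => ?_⟩
      fin_cases n <;> simp_all)
  exact ⟨q, hq 0, hq 1, hq 2, hq 3⟩

lemma aux_helly3 {ι : Type*} (G : ι → Set (Fin 2 → ℝ)) (hc : ∀ i, Convex ℝ (G i))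
    (hk : ∀ i, IsCompact (G i)) (h3 : ∀ i j k, ∃ q, q ∈ G i ∧ q ∈ G j ∧ q ∈ G k) :
    ∃ q, ∀ i, q ∈ G i := by
  classical
  have := Convex.helly_theorem_compact' (𝕜 := ℝ) (F := G) hc hk (by
    intro I hI
    have hI' : I.card ≤ 3 := by simpa using hI
    interval_cases hcard : I.card
    · rw [Finset.card_eq_zero] at hcard
      subst hcard
      simp
    · obtain ⟨i, rfl⟩ := Finset.card_eq_one.1 hcard
      obtain ⟨q, hq, -⟩ := h3 i i i
      exact ⟨q, by simpa using hq⟩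
    · obtain ⟨i, j, -, rfl⟩ := Finset.card_eq_two.1 hcard
      obtain ⟨q, hq, hq', -⟩ := h3 i j j
      exact ⟨q, by simpa using ⟨hq, hq'⟩⟩
    · obtain ⟨i, j, k, -, -, -, rfl⟩ := Finset.card_eq_three.1 hcard
      obtain ⟨q, hq, hq', hq2⟩ := h3 i j k
      exact ⟨q, by simpa using ⟨hq, hq', hq2⟩⟩)
  obtain ⟨q, hq⟩ := this
  exact ⟨q, by simpa using hq⟩

lemma aux_hellyD {ι : Type*} (G : ι → Set (Fin 2 → ℝ)) (hc : ∀ i, Convex ℝ (G i))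
    (hk : ∀ i, IsCompact (G i)) (h3 : ∀ i j k, ∃ q, q ∈ G i ∧ q ∈ G j ∧ q ∈ G k)
    (D : Set (Fin 2 → ℝ)) (hDc : Convex ℝ D) (hDcl : IsClosed D) (hne : Nonempty ι)
    (h2 : ∀ i j, ∃ q, q ∈ D ∧ q ∈ G i ∧ q ∈ G j) : ∃ q, q ∈ D ∧ ∀ i, q ∈ G i := by
  obtain ⟨q, hq⟩ := aux_helly3 (fun i => G i ∩ D) (fun i => (hc i).inter hDc)
    (fun i => (hk i).inter_right hDcl) (by
      intro i j k
      obtain ⟨q, a, b, c, d⟩ := aux_four hDc (hc i) (hc j) (hc k) (h3 i j k) (h2 j k) (h2 i k)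
        (h2 i j)
      exact ⟨q, ⟨b, a⟩, ⟨c, a⟩, ⟨d, a⟩⟩)
  exact ⟨q, (hq hne.some).2, fun i => (hq i).1⟩

lemma aux_cross {C : Set (Fin 2 → ℝ)} (hC : Convex ℝ C) {p q : (Fin 2 → ℝ)} (hp : p ∈ C) (hq : q ∈ C) (i : Fin 2)
    {t : ℝ} (h1 : p i ≤ t) (h2 : t ≤ q i) : ∃ m ∈ C, m i = t ∧
      ∀ j l u, l ≤ p j → l ≤ q j → p j ≤ u → q j ≤ u → l ≤ m j ∧ m j ≤ u := by
  obtain ⟨a, b, ha, hb, hab, hm⟩ : ∃ a b : ℝ, 0 ≤ a ∧ 0 ≤ b ∧ a + b = 1 ∧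
      a * p i + b * q i = t := by
    have : t ∈ segment ℝ (p i) (q i) := by
      rw [segment_eq_Icc (h1.trans h2)]; exact ⟨h1, h2⟩
    obtain ⟨a, b, ha, hb, hab, hm⟩ := this
    exact ⟨a, b, ha, hb, hab, by simpa using hm⟩
  refine ⟨a • p + b • q, hC hp hq ha hb hab, by simpa using hm, ?_⟩
  intro j l u h3 h4 h5 h6
  simp only [Pi.add_apply, Pi.smul_apply, smul_eq_mul]
  constructor
  · have e2 : l = a * l + b * l := by rw [← add_mul, hab, one_mul]
    linarith [mul_le_mul_of_nonneg_left h3 ha, mul_le_mul_of_nonneg_left h4 hb]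
  · have e2 : u = a * u + b * u := by rw [← add_mul, hab, one_mul]
    linarith [mul_le_mul_of_nonneg_left h5 ha, mul_le_mul_of_nonneg_left h6 hb]

lemma aux_strip_convex (i : Fin 2) (l u : ℝ) : Convex ℝ {q : (Fin 2 → ℝ) | l ≤ q i ∧ q i ≤ u} :=
  (convex_Icc l u).linear_preimage (LinearMap.proj (R := ℝ) (φ := fun _ : Fin 2 => ℝ) i)

lemma aux_strip_closed (i : Fin 2) (l u : ℝ) : IsClosed {q : (Fin 2 → ℝ) | l ≤ q i ∧ q i ≤ u} :=
  (isClosed_le continuous_const (continuous_apply i)).inter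
    (isClosed_le (continuous_apply i) continuous_const)

/-- two parallel strips -/
lemma aux_par {C : Set (Fin 2 → ℝ)} (hC : Convex ℝ C) (i : Fin 2) {l u l' u' : ℝ} (h1 : l ≤ u') (h2 : l' ≤ u)
    (hl : l ≤ u) (hl' : l' ≤ u')
    {p q : (Fin 2 → ℝ)} (hp : p ∈ C) (hq : q ∈ C) (hpi : l ≤ p i ∧ p i ≤ u) (hqi : l' ≤ q i ∧ q i ≤ u') :
    ∃ m ∈ C, (l ≤ m i ∧ m i ≤ u) ∧ (l' ≤ m i ∧ m i ≤ u') := by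
  rcases lt_or_ge (p i) l' with h | h
  · obtain ⟨m, hm, e, -⟩ := aux_cross hC hp hq i h.le hqi.1
    exact ⟨m, hm, by rw [e]; constructor <;> constructor <;> linarith⟩
  rcases lt_or_ge u' (p i) with h' | h'
  · obtain ⟨m, hm, e, -⟩ := aux_cross hC hq hp i hqi.2 h'.le
    exact ⟨m, hm, by rw [e]; constructor <;> constructor <;> linarith⟩
  exact ⟨p, hp, hpi, h, h'⟩

lemma aux_box {K : Type*} [Nonempty K] {C : Set (Fin 2 → ℝ)} (hC : Convex ℝ C) (hCk : IsCompact C)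
    (lo hi : K → (Fin 2 → ℝ)) (hlh : ∀ k k' i, lo k i ≤ hi k' i)
    (h : ∀ k : Fin 2 → K, ∃ q ∈ C, ∀ i, lo (k i) i ≤ q i ∧ q i ≤ hi (k i) i) :
    ∃ q ∈ C, ∀ k i, lo k i ≤ q i ∧ q i ≤ hi k i := by
  let S : K × Fin 2 → Set (Fin 2 → ℝ) := fun a => {q | lo a.1 a.2 ≤ q a.2 ∧ q a.2 ≤ hi a.1 a.2}
  have hSc : ∀ a, Convex ℝ (S a) := fun a => aux_strip_convex _ _ _
  have pair : ∀ a b, ∃ q, q ∈ C ∧ q ∈ S a ∧ q ∈ S b := by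
    rintro ⟨k, i⟩ ⟨k', i'⟩
    by_cases hii : i = i'
    · subst hii
      obtain ⟨p, hp, hp'⟩ := h (fun _ => k)
      obtain ⟨q, hq, hq'⟩ := h (fun _ => k')
      exact aux_par hC i (hlh _ _ _) (hlh _ _ _) (hlh _ _ _) (hlh _ _ _) hp hq (hp' i) (hq' i)
    · obtain ⟨p, hp, hp'⟩ := h (fun j => if j = i then k else k')
      refine ⟨p, hp, ?_, ?_⟩
      · have := hp' i
        rw [if_pos rfl] at this
        exact this
      · have := hp' i'
        rw [if_neg (fun e => hii e.symm)] at this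
        exact this
  have trip : ∀ a b c, ∃ q, q ∈ S a ∧ q ∈ S b ∧ q ∈ S c := by
    intro a b c
    have bdd : ∀ i, BddAbove (Set.range fun k => lo k i) := fun i =>
      ⟨hi (Classical.arbitrary K) i, by rintro _ ⟨k, rfl⟩; exact hlh _ _ _⟩
    have key : ∀ a, (fun i => ⨆ k, lo k i) ∈ S a := fun a =>
      ⟨le_ciSup (bdd a.2) a.1, ciSup_le fun k => hlh _ _ _⟩
    exact ⟨_, key a, key b, key c⟩
  obtain ⟨q, hq⟩ := aux_helly3 (fun a => C ∩ S a) (fun a => hC.inter (hSc a))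
    (fun a => hCk.inter_right (aux_strip_closed _ _ _)) (by
      intro a b c
      obtain ⟨q, h1, h2, h3, h4⟩ := aux_four hC (hSc a) (hSc b) (hSc c) (trip a b c)
        (pair b c) (pair a c) (pair a b)
      exact ⟨q, ⟨h1, h2⟩, ⟨h1, h3⟩, ⟨h1, h4⟩⟩)
  exact ⟨q, (hq (Classical.arbitrary K, 0)).1, fun k i => (hq (k, i)).2⟩

/-- once a common point `e` on the line `q 0 = t` is known -/
lemma aux_line {C₁ C₂ : Set (Fin 2 → ℝ)} (h₁ : Convex ℝ C₁) (h₂ : Convex ℝ C₂) {A B : (Fin 2 → ℝ)} {t : ℝ}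
    (ht : A 0 ≤ t ∧ t ≤ B 0) (hAB : A 1 ≤ B 1) {e p q : (Fin 2 → ℝ)}
    (he₁ : e ∈ C₁) (he₂ : e ∈ C₂) (hp : p ∈ C₁) (hq : q ∈ C₂) (e0 : e 0 = t) (p0 : p 0 = t)
    (q0 : q 0 = t) (hpi : A 1 ≤ p 1 ∧ p 1 ≤ B 1) (hqi : A 1 ≤ q 1 ∧ q 1 ≤ B 1) :
    ∃ m, (∀ i, A i ≤ m i ∧ m i ≤ B i) ∧ m ∈ C₁ ∧ m ∈ C₂ := by
  rcases lt_or_ge (e 1) (A 1) with h | h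
  · obtain ⟨m, hm, hm1, hm'⟩ := aux_cross h₁ he₁ hp 1 h.le hpi.1
    obtain ⟨n, hn, hn1, hn'⟩ := aux_cross h₂ he₂ hq 1 h.le hqi.1
    have hm0 := hm' 0 t t e0.ge p0.ge e0.le p0.le
    have hn0 := hn' 0 t t e0.ge q0.ge e0.le q0.le
    have : m = n := by
      ext i; fin_cases i
      · simp; linarith
      · simp; linarith
    refine ⟨m, ?_, hm, this ▸ hn⟩
    rw [Fin.forall_fin_two]
    constructor <;> constructor <;> linarith
  rcases lt_or_ge (B 1) (e 1) with h' | h'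
  · obtain ⟨m, hm, hm1, hm'⟩ := aux_cross h₁ hp he₁ 1 hpi.2 h'.le
    obtain ⟨n, hn, hn1, hn'⟩ := aux_cross h₂ hq he₂ 1 hqi.2 h'.le
    have hm0 := hm' 0 t t p0.ge e0.ge p0.le e0.le
    have hn0 := hn' 0 t t q0.ge e0.ge q0.le e0.le
    have : m = n := by
      ext i; fin_cases i
      · simp; linarith
      · simp; linarith
    refine ⟨m, ?_, hm, this ▸ hn⟩
    rw [Fin.forall_fin_two]
    constructor <;> constructor <;> linarith
  refine ⟨e, ?_, he₁, he₂⟩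
  rw [Fin.forall_fin_two]
  constructor <;> constructor <;> linarith

lemma aux_corner {C₁ C₂ : Set (Fin 2 → ℝ)} (h₁ : Convex ℝ C₁) (h₂ : Convex ℝ C₂) {A B : (Fin 2 → ℝ)}
    (p : (Fin 2 → ℝ)) (hp : p ∈ C₁) (hpb : ∀ i, A i ≤ p i ∧ p i ≤ B i)
    (q : (Fin 2 → ℝ)) (hq : q ∈ C₂) (hqb : ∀ i, A i ≤ q i ∧ q i ≤ B i)
    (hd : ∀ i, ∃ d, d ∈ C₁ ∧ d ∈ C₂ ∧ A i ≤ d i ∧ d i ≤ B i) :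
    ∃ m, (∀ i, A i ≤ m i ∧ m i ≤ B i) ∧ m ∈ C₁ ∧ m ∈ C₂ := by
  obtain ⟨d, hd1, hd2, hdA, hdB⟩ := hd 0
  obtain ⟨c, hc1, hc2, hcA, hcB⟩ := hd 1
  have hA0 := (hpb 0).1.trans (hpb 0).2
  have hA1 := (hpb 1).1.trans (hpb 1).2
  rcases lt_or_ge (c 0) (A 0) with h | h
  · obtain ⟨e, ⟨he1, he2⟩, e0, -⟩ := aux_cross (h₁.inter h₂) ⟨hc1, hc2⟩ ⟨hd1, hd2⟩ 0 h.le hdA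
    obtain ⟨p', hp', p0, hpp⟩ := aux_cross h₁ hc1 hp 0 h.le (hpb 0).1
    obtain ⟨q', hq', q0, hqq⟩ := aux_cross h₂ hc2 hq 0 h.le (hqb 0).1
    exact aux_line h₁ h₂ ⟨le_rfl, hA0⟩ hA1 he1 he2 hp' hq' e0 p0 q0
      (hpp 1 _ _ hcA (hpb 1).1 hcB (hpb 1).2) (hqq 1 _ _ hcA (hqb 1).1 hcB (hqb 1).2)
  rcases lt_or_ge (B 0) (c 0) with h' | h'
  · obtain ⟨e, ⟨he1, he2⟩, e0, -⟩ := aux_cross (h₁.inter h₂) ⟨hd1, hd2⟩ ⟨hc1, hc2⟩ 0 hdB h'.le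
    obtain ⟨p', hp', p0, hpp⟩ := aux_cross h₁ hp hc1 0 (hpb 0).2 h'.le
    obtain ⟨q', hq', q0, hqq⟩ := aux_cross h₂ hq hc2 0 (hqb 0).2 h'.le
    exact aux_line h₁ h₂ ⟨hA0, le_rfl⟩ hA1 he1 he2 hp' hq' e0 p0 q0
      (hpp 1 _ _ (hpb 1).1 hcA (hpb 1).2 hcB) (hqq 1 _ _ (hqb 1).1 hcA (hqb 1).2 hcB)
  refine ⟨c, ?_, hc1, hc2⟩
  rw [Fin.forall_fin_two]
  exact ⟨⟨h, h'⟩, hcA, hcB⟩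

lemma aux_Icc_convex (A B : (Fin 2 → ℝ)) : Convex ℝ {q : (Fin 2 → ℝ) | ∀ i, A i ≤ q i ∧ q i ≤ B i} := by
  have : {q : (Fin 2 → ℝ) | ∀ i, A i ≤ q i ∧ q i ≤ B i} = ⋂ i, {q : (Fin 2 → ℝ) | A i ≤ q i ∧ q i ≤ B i} := by
    ext; simp
  rw [this]
  exact convex_iInter fun i => aux_strip_convex _ _ _

lemma aux_Icc_closed (A B : (Fin 2 → ℝ)) : IsClosed {q : (Fin 2 → ℝ) | ∀ i, A i ≤ q i ∧ q i ≤ B i} := by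
  have : {q : (Fin 2 → ℝ) | ∀ i, A i ≤ q i ∧ q i ≤ B i} = ⋂ i, {q : (Fin 2 → ℝ) | A i ≤ q i ∧ q i ≤ B i} := by
    ext; simp
  rw [this]
  exact isClosed_iInter fun i => aux_strip_closed _ _ _

lemma aux_general {U K : Type*} [Nonempty U] [Nonempty K] (G : U → Set (Fin 2 → ℝ))
    (hc : ∀ u, Convex ℝ (G u)) (hk : ∀ u, IsCompact (G u)) (lo hi : K → (Fin 2 → ℝ))
    (h3 : ∀ i j k, ∃ q, q ∈ G i ∧ q ∈ G j ∧ q ∈ G k)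
    (hlh : ∀ k k' i, lo k i ≤ hi k' i)
    (h1 : ∀ u, ∀ k : Fin 2 → K, ∃ q ∈ G u, ∀ i, lo (k i) i ≤ q i ∧ q i ≤ hi (k i) i)
    (h2 : ∀ k i, ∃ q, (∀ u, q ∈ G u) ∧ lo k i ≤ q i ∧ q i ≤ hi k i) :
    ∃ q, (∀ u, q ∈ G u) ∧ ∀ k i, lo k i ≤ q i ∧ q i ≤ hi k i := by
  have bdd : ∀ i, BddAbove (Set.range fun k => lo k i) := fun i =>
      ⟨hi (Classical.arbitrary K) i, by rintro _ ⟨k, rfl⟩; exact hlh _ _ _⟩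
  have bdd' : ∀ i, BddBelow (Set.range fun k => hi k i) := fun i =>
      ⟨lo (Classical.arbitrary K) i, by rintro _ ⟨k, rfl⟩; exact hlh _ _ _⟩
  let A : (Fin 2 → ℝ) := fun i => ⨆ k, lo k i
  let B : (Fin 2 → ℝ) := fun i => ⨅ k, hi k i
  have hAB : ∀ q : (Fin 2 → ℝ), ∀ i, (A i ≤ q i ∧ q i ≤ B i) ↔ ∀ k, lo k i ≤ q i ∧ q i ≤ hi k i := by
    intro q i
    constructor
    · rintro ⟨h, h'⟩ k
      exact ⟨(le_ciSup (bdd i) k).trans h, h'.trans (ciInf_le (bdd' i) k)⟩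
    · intro h
      exact ⟨ciSup_le fun k => (h k).1, le_ciInf fun k => (h k).2⟩
  have hbox : ∀ u, ∃ q ∈ G u, ∀ i, A i ≤ q i ∧ q i ≤ B i := by
    intro u
    obtain ⟨q, hq, hq'⟩ := aux_box (hc u) (hk u) lo hi hlh (h1 u)
    exact ⟨q, hq, fun i => (hAB q i).2 fun k => hq' k i⟩
  have hproj : ∀ i, ∃ q, (∀ u, q ∈ G u) ∧ A i ≤ q i ∧ q i ≤ B i := by
    intro i
    let Z : Set (Fin 2 → ℝ) := ⋂ u, G u
    have hZ : Convex ℝ Z := convex_iInter hc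
    have hZk : IsCompact Z := by
      have u := Classical.arbitrary U
      exact (hk u).of_isClosed_subset (isClosed_iInter fun u => (hk u).isClosed)
        (Set.iInter_subset _ u)
    have hmem : ∀ q, q ∈ Z ↔ ∀ u, q ∈ G u := fun q => Set.mem_iInter
    have := aux_helly3 (fun k : K => Z ∩ {q | lo k i ≤ q i ∧ q i ≤ hi k i})
      (fun k => hZ.inter (aux_strip_convex _ _ _))
      (fun k => hZk.inter_right (aux_strip_closed _ _ _)) (by
        have pair : ∀ a b, ∃ q, q ∈ Z ∧ q ∈ {q : (Fin 2 → ℝ) | lo a i ≤ q i ∧ q i ≤ hi a i} ∧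
            q ∈ {q : (Fin 2 → ℝ) | lo b i ≤ q i ∧ q i ≤ hi b i} := by
          intro a b
          obtain ⟨p, hp, hp'⟩ := h2 a i
          obtain ⟨q, hq, hq'⟩ := h2 b i
          exact aux_par hZ i (hlh _ _ _) (hlh _ _ _) (hlh _ _ _) (hlh _ _ _)
            ((hmem p).2 hp) ((hmem q).2 hq) hp' hq'
        intro a b c
        obtain ⟨q, h1, h2, h3, h4⟩ := aux_four hZ (aux_strip_convex i (lo a i) (hi a i))
          (aux_strip_convex i (lo b i) (hi b i)) (aux_strip_convex i (lo c i) (hi c i))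
          ⟨A, ⟨le_ciSup (bdd i) a, ciSup_le fun k => hlh _ _ _⟩,
            ⟨le_ciSup (bdd i) b, ciSup_le fun k => hlh _ _ _⟩,
            ⟨le_ciSup (bdd i) c, ciSup_le fun k => hlh _ _ _⟩⟩
          (pair b c) (pair a c) (pair a b)
        exact ⟨q, ⟨h1, h2⟩, ⟨h1, h3⟩, ⟨h1, h4⟩⟩)
    obtain ⟨q, hq⟩ := this
    exact ⟨q, (hmem q).1 (hq (Classical.arbitrary K)).1, (hAB q i).2 fun k => (hq k).2⟩
  obtain ⟨q, hq, hq'⟩ := aux_hellyD G hc hk h3 {q : (Fin 2 → ℝ) | ∀ i, A i ≤ q i ∧ q i ≤ B i}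
    (aux_Icc_convex A B) (aux_Icc_closed A B) inferInstance (by
      intro u v
      obtain ⟨p, hp, hpb⟩ := hbox u
      obtain ⟨q, hq, hqb⟩ := hbox v
      exact aux_corner (hc u) (hc v) p hp hpb q hq hqb (fun i => by
        obtain ⟨d, hd, hd'⟩ := hproj i
        exact ⟨d, hd u, hd v, hd'⟩))
  exact ⟨q, hq', fun k i => (hAB q i).1 (hq i) k⟩

lemma aux_mem {A : Set (Fin 2 → ℝ)} {r : ℝ} (hr : 0 ≤ r) (q : (Fin 2 → ℝ)) :
    q ∈ A + closedBall (0 : (Fin 2 → ℝ)) r ↔ ∃ w ∈ A, ∀ i, |q i - w i| ≤ r := by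
  rw [Set.mem_add]
  constructor
  · rintro ⟨w, hw, b, hb, rfl⟩
    refine ⟨w, hw, fun i => ?_⟩
    rw [mem_closedBall_zero_iff, pi_norm_le_iff_of_nonneg hr] at hb
    simpa using hb i
  · rintro ⟨w, hw, h⟩
    refine ⟨w, hw, q - w, ?_, by simp⟩
    rw [mem_closedBall_zero_iff, pi_norm_le_iff_of_nonneg hr]
    simpa using h

/-- McShane extension from a finite set. -/
lemma aux_ext {M : Type*} (ρ : M → M → ℝ) (hρ_refl : ∀ x, ρ x x = 0)
    (hρ_symm : ∀ x y, ρ x y = ρ y x) (hρ_tri : ∀ x y z, ρ x z ≤ ρ x y + ρ y z)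
    (S : Finset M) (hS : S.Nonempty) (f : M → ℝ) (hf : ∀ x ∈ S, ∀ y ∈ S, |f x - f y| ≤ ρ x y) :
    ∃ g : M → ℝ, (∀ x ∈ S, g x = f x) ∧ ∀ x y, |g x - g y| ≤ ρ x y := by
  refine ⟨fun w => S.inf' hS (fun s => f s + ρ s w), ?_, ?_⟩
  · intro x hx
    apply le_antisymm
    · have := Finset.inf'_le (fun s => f s + ρ s x) hx
      rw [hρ_refl, add_zero] at this
      exact this
    · apply Finset.le_inf'
      intro s hs
      have := abs_le.1 (hf s hs x hx)
      linarith
  · have key : ∀ x y, S.inf' hS (fun s => f s + ρ s x) ≤ S.inf' hS (fun s => f s + ρ s y) + ρ x y := by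
      intro x y
      rw [← sub_le_iff_le_add]
      apply Finset.le_inf'
      intro s hs
      have := Finset.inf'_le (fun s => f s + ρ s x) hs
      have h2 := hρ_tri s y x
      rw [hρ_symm y x] at h2
      linarith
    intro x y
    have h1 := key x y
    have h2 := key y x
    rw [hρ_symm y x] at h2
    rw [abs_le]
    constructor <;> simp only <;> linarith

lemma aux_mix (δ r s l1 l2 γ : ℝ) (hδ : 0 ≤ δ) (hr : 0 ≤ r) (hl1 : 1 ≤ l1) (hl2 : 3 * l1 ≤ l2)
    (hγ : l2 * (3 * l2 + l1) ≤ γ * (l2 - l1)) (hγ2 : l2 ≤ γ) :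
    ∃ t : ℝ, 0 ≤ t ∧ t ≤ 1 ∧
      (1 - t) * (l2 * (r + δ) + l1 * (δ + s)) + t * (l1 * (r + s)) ≤ l2 * r + l1 * s ∧
      (1 - t) * (l1 * (δ + s)) + t * (l2 * (r + δ) + l1 * (r + s)) ≤ γ * δ + l1 * s := by
  rcases hδ.eq_or_lt with h | h
  · refine ⟨0, le_rfl, zero_le_one, ?_, ?_⟩ <;> subst h <;> linarith
  have hN : 0 < (l2 + l1) * δ := mul_pos (by linarith) h
  have hR : 0 ≤ (l2 - l1) * r := mul_nonneg (by linarith) hr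
  obtain ⟨t, ht⟩ : ∃ t, t = (l2 + l1) * δ / ((l2 + l1) * δ + (l2 - l1) * r) := ⟨_, rfl⟩
  have hD : 0 < (l2 + l1) * δ + (l2 - l1) * r := by linarith
  have htD : t * ((l2 + l1) * δ + (l2 - l1) * r) = (l2 + l1) * δ := by
    rw [ht]; field_simp
  refine ⟨t, ?_, ?_, ?_, ?_⟩
  · rw [ht]; positivity
  · rw [ht, div_le_one hD]; linarith
  · nlinarith
  · have h1 : (l2 - l1) * l1 + (l1 + l2) ^ 2 ≤ γ * (l2 - l1) := by nlinarith
    have h2 : ((l2 - l1) * r * (l1 * δ) + (l2 + l1) * δ * ((l1 + l2) * r + l2 * δ)) ≤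
        γ * δ * ((l2 + l1) * δ + (l2 - l1) * r) := by
      have e1 := mul_le_mul_of_nonneg_right h1 (mul_nonneg hr hδ)
      have e2 := mul_le_mul_of_nonneg_right hγ2 (mul_nonneg hN.le hδ)
      nlinarith
    have h3 : ((1 - t) * (l1 * δ) + t * ((l1 + l2) * r + l2 * δ)) *
        ((l2 + l1) * δ + (l2 - l1) * r) ≤ γ * δ * ((l2 + l1) * δ + (l2 - l1) * r) := by
      have e : ((1 - t) * (l1 * δ) + t * ((l1 + l2) * r + l2 * δ)) *
        ((l2 + l1) * δ + (l2 - l1) * r) = ((l2 - l1) * r * (l1 * δ) + (l2 + l1) * δ * ((l1 + l2) * r + l2 * δ)) := by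
        linear_combination ((l1 + l2) * r + l2 * δ - l1 * δ) * htD
      rw [e]; exact h2
    have h4 := le_of_mul_le_mul_right h3 hD
    linarith

lemma aux_clamp (l u w s : ℝ) (hs : 0 ≤ s) (hlu : l ≤ u) (h1 : l - s ≤ w) (h2 : w ≤ u + s) :
    ∃ q, |q - w| ≤ s ∧ l ≤ q ∧ q ≤ u := by
  rcases lt_or_ge w l with h | h
  · exact ⟨l, abs_le.2 ⟨by linarith, by linarith⟩, le_rfl, hlu⟩
  rcases lt_or_ge u w with h' | h'
  · exact ⟨u, abs_le.2 ⟨by linarith, by linarith⟩, hlu, le_rfl⟩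
  exact ⟨w, by simpa using hs, h, h'⟩

/-- The main theorem in `ℓ∞²`, i.e. `ℝ²` with the sup norm (realized as the
Pi-type `Fin 2 → ℝ` with its sup norm; its closed unit ball is `[-1,1]²`). -/
theorem core_linf_two_dim
    {M : Type*} (ρ : M → M → ℝ)
    (hρ_refl : ∀ x, ρ x x = 0)
    (hρ_symm : ∀ x y, ρ x y = ρ y x)
    (hρ_tri : ∀ x y z, ρ x z ≤ ρ x y + ρ y z)
    (F : M → Set (Fin 2 → ℝ))
    (hFne : ∀ x, (F x).Nonempty)
    (hFcp : ∀ x, IsCompact (F x))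
    (hFcv : ∀ x, Convex ℝ (F x))
    -- finiteness hypothesis: selections on subsets of at most 4 points
    (hfin : ∀ M' : Finset M, M'.card ≤ 4 →
      ∃ f : M → (Fin 2 → ℝ), (∀ x ∈ M', f x ∈ F x) ∧
        ∀ x ∈ M', ∀ y ∈ M', ‖f x - f y‖ ≤ ρ x y)
    (lam1 lam2 γ : ℝ) (hlam1 : 1 ≤ lam1) (hlam2 : 3 * lam1 ≤ lam2)
    (hγ : lam2 * (3 * lam2 + lam1) / (lam2 - lam1) ≤ γ)
    -- the first and second balanced refinements of `F`
    (F1 F2 : M → Set (Fin 2 → ℝ))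
    (hF1 : ∀ x, F1 x = ⋂ z, F z + closedBall (0 : Fin 2 → ℝ) (lam1 * ρ x z))
    (hF2 : ∀ x, F2 x = ⋂ z, F1 z + closedBall (0 : Fin 2 → ℝ) (lam2 * ρ x z)) :
    (∀ x, (F2 x).Nonempty) ∧ ∀ x y, hausDistB (F2 x) (F2 y) ≤ γ * ρ x y := by
  have h0 : ∀ x y, 0 ≤ ρ x y := by
    intro x y
    have := hρ_tri x y x
    rw [hρ_refl, hρ_symm y x] at this
    linarith
  have hl1 : 0 < lam1 := by linarith
  have hl2 : 0 < lam2 := by linarith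
  have hr1 : ∀ x y, 0 ≤ lam1 * ρ x y := fun x y => mul_nonneg hl1.le (h0 x y)
  have hr2 : ∀ x y, 0 ≤ lam2 * ρ x y := fun x y => mul_nonneg hl2.le (h0 x y)
  have m1 : ∀ {s t : ℝ}, s ≤ t → lam1 * s ≤ lam1 * t := fun h => mul_le_mul_of_nonneg_left h hl1.le
  have m2 : ∀ {s t : ℝ}, s ≤ t → lam2 * s ≤ lam2 * t := fun h => mul_le_mul_of_nonneg_left h hl2.le
  have hγ' : lam2 * (3 * lam2 + lam1) ≤ γ * (lam2 - lam1) :=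
    (div_le_iff₀ (by linarith)).1 hγ
  have hγ2 : lam2 ≤ γ := by
    refine le_trans ?_ hγ
    rw [le_div_iff₀ (by linarith)]
    apply m2; linarith
  let G : M → M → Set (Fin 2 → ℝ) := fun x u => F u + closedBall (0 : Fin 2 → ℝ) (lam1 * ρ x u)
  have hG : ∀ x u q, q ∈ G x u ↔ ∃ w ∈ F u, ∀ i, |q i - w i| ≤ lam1 * ρ x u :=
    fun x u q => aux_mem (hr1 x u) q
  have hGc : ∀ x u, Convex ℝ (G x u) := fun x u => (hFcv u).add (convex_closedBall _ _)
  have hGk : ∀ x u, IsCompact (G x u) := fun x u => (hFcp u).add (isCompact_closedBall _ _)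
  have hF1' : ∀ x q, q ∈ F1 x ↔ ∀ u, q ∈ G x u := by
    intro x q; rw [hF1 x]; exact Set.mem_iInter
  have hF2' : ∀ x q, q ∈ F2 x ↔ ∀ z, ∃ w ∈ F1 z, ∀ i, |q i - w i| ≤ lam2 * ρ x z := by
    intro x q; rw [hF2 x, Set.mem_iInter]
    exact forall_congr' fun z => aux_mem (hr2 x z) q
  -- selections on four points, extended to everything
  have sel : ∀ u u' v v', ∃ g : M → (Fin 2 → ℝ), g u ∈ F u ∧ g u' ∈ F u' ∧ g v ∈ F v ∧ g v' ∈ F v' ∧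
      ∀ x y i, |g x i - g y i| ≤ ρ x y := by
    classical
    intro u u' v v'
    obtain ⟨f, hf, hfl⟩ := hfin {u, u', v, v'} Finset.card_le_four
    have := fun i => aux_ext ρ hρ_refl hρ_symm hρ_tri {u, u', v, v'} ⟨u, by simp⟩ (fun x => f x i)
      (fun x hx y hy => by
        have := (pi_norm_le_iff_of_nonneg (h0 x y)).1 (hfl x hx y hy) i
        simpa using this)
    choose g hg hgl using this
    have e : ∀ x ∈ ({u, u', v, v'} : Finset M), (fun i => g i x) = f x := by
      intro x hx; ext i; exact hg i x hx
    refine ⟨fun x i => g i x, ?_, ?_, ?_, ?_, fun x y i => hgl i x y⟩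
    · beta_reduce; rw [e u (by simp)]; exact hf u (by simp)
    · beta_reduce; rw [e u' (by simp)]; exact hf u' (by simp)
    · beta_reduce; rw [e v (by simp)]; exact hf v (by simp)
    · beta_reduce; rw [e v' (by simp)]; exact hf v' (by simp)
  have selG : ∀ (g : M → (Fin 2 → ℝ)), (∀ x y i, |g x i - g y i| ≤ ρ x y) → ∀ x u, g u ∈ F u →
      g x ∈ G x u := by
    intro g hg x u hu
    rw [hG]
    refine ⟨g u, hu, fun i => (hg x u i).trans ?_⟩
    nlinarith [h0 x u]
  have trip : ∀ x u v w, ∃ q, q ∈ G x u ∧ q ∈ G x v ∧ q ∈ G x w := by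
    intro x u v w
    obtain ⟨g, h1, h2, h3, -, h⟩ := sel u v w w
    exact ⟨g x, selG g h x u h1, selG g h x v h2, selG g h x w h3⟩
  have F1ne : ∀ x, (F1 x).Nonempty := by
    intro x
    obtain ⟨q, hq⟩ := aux_helly3 (G x) (hGc x) (hGk x) (trip x)
    exact ⟨q, (hF1' x q).2 hq⟩
  have F1c : ∀ x, Convex ℝ (F1 x) := by
    intro x; rw [hF1 x]; exact convex_iInter fun u => hGc x u
  have F1k : ∀ x, IsCompact (F1 x) := by
    intro x; rw [hF1 x]
    exact (hGk x x).of_isClosed_subset (isClosed_iInter fun u => (hGk x u).isClosed)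
        (Set.iInter_subset _ x)
  have hmin : ∀ x i, ∃ a ∈ F1 x, ∀ q ∈ F1 x, a i ≤ q i := by
    intro x i
    obtain ⟨a, ha, h⟩ := (F1k x).exists_isMinOn (F1ne x) (continuous_apply i).continuousOn
    exact ⟨a, ha, fun q hq => h hq⟩
  have hmax : ∀ x i, ∃ a ∈ F1 x, ∀ q ∈ F1 x, q i ≤ a i := by
    intro x i
    obtain ⟨a, ha, h⟩ := (F1k x).exists_isMaxOn (F1ne x) (continuous_apply i).continuousOn
    exact ⟨a, ha, fun q hq => h hq⟩
  choose a' ha' haq using hmin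
  choose b' hb' hbq using hmax
  obtain ⟨a, ha⟩ : ∃ a : M → Fin 2 → ℝ, ∀ x i, a x i = a' x i i := ⟨fun x i => a' x i i, fun _ _ => rfl⟩
  obtain ⟨b, hb⟩ : ∃ b : M → Fin 2 → ℝ, ∀ x i, b x i = b' x i i := ⟨fun x i => b' x i i, fun _ _ => rfl⟩
  have hab : ∀ x i, a x i ≤ b x i := fun x i => by
    rw [ha, hb]; exact haq x i _ (hb' x i)
  have hin : ∀ x, ∀ q ∈ F1 x, ∀ i, a x i ≤ q i ∧ q i ≤ b x i := fun x q hq i => by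
    rw [ha, hb]; exact ⟨haq x i q hq, hbq x i q hq⟩
  have hex : ∀ x i l u, l ≤ u → a x i ≤ u → l ≤ b x i → ∃ q ∈ F1 x, l ≤ q i ∧ q i ≤ u := by
    intro x i l u h1 h2 h3
    obtain ⟨m, hm, e, -⟩ := aux_cross (F1c x) (ha' x i) (hb' x i) i (t := max l (a x i))
      (by rw [← ha]; exact le_max_right _ _) (by rw [← hb]; exact max_le h3 (hab x i))
    exact ⟨m, hm, by rw [e]; exact le_max_left _ _, by rw [e]; exact max_le h1 h2⟩
  -- projections of F1 are close
  have hclose : ∀ z z' i, a z i ≤ b z' i + ρ z z' := by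
    intro z z' i
    by_contra hcon
    push Not at hcon
    obtain ⟨ε, hε, hε2⟩ : ∃ ε : ℝ, 0 < ε ∧ b z' i + ρ z z' + 2 * ε < a z i :=
      ⟨(a z i - (b z' i + ρ z z')) / 3, by linarith, by linarith⟩
    have k1 : ∃ u v, ∀ q, q ∈ G z u → q ∈ G z v → a z i - ε < q i := by
      by_contra hc
      push Not at hc
      obtain ⟨q, hq, hq'⟩ := aux_hellyD (G z) (hGc z) (hGk z) (trip z) {q | q i ≤ a z i - ε}
        ((convex_Iic (a z i - ε)).linear_preimage
          (LinearMap.proj (R := ℝ) (φ := fun _ : Fin 2 => ℝ) i))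
        (isClosed_le (continuous_apply i) continuous_const) ⟨z⟩ (by
          intro u v
          obtain ⟨q, h1, h2, h3⟩ := hc u v
          exact ⟨q, h3, h1, h2⟩)
      have := (hin z q ((hF1' z q).2 hq') i).1
      have hq2 : q i ≤ a z i - ε := hq
      linarith
    have k2 : ∃ u v, ∀ q, q ∈ G z' u → q ∈ G z' v → q i < b z' i + ε := by
      by_contra hc
      push Not at hc
      obtain ⟨q, hq, hq'⟩ := aux_hellyD (G z') (hGc z') (hGk z') (trip z') {q | b z' i + ε ≤ q i}
        ((convex_Ici (b z' i + ε)).linear_preimage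
          (LinearMap.proj (R := ℝ) (φ := fun _ : Fin 2 => ℝ) i))
        (isClosed_le continuous_const (continuous_apply i)) ⟨z⟩ (by
          intro u v
          obtain ⟨q, h1, h2, h3⟩ := hc u v
          exact ⟨q, h3, h1, h2⟩)
      have := (hin z' q ((hF1' z' q).2 hq') i).2
      have hq2 : b z' i + ε ≤ q i := hq
      linarith
    obtain ⟨u, v, k1⟩ := k1
    obtain ⟨u', v', k2⟩ := k2
    obtain ⟨g, g1, g2, g3, g4, hg⟩ := sel u v u' v'
    have e1 := k1 (g z) (selG g hg z u g1) (selG g hg z v g2)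
    have e2 := k2 (g z') (selG g hg z' u' g3) (selG g hg z' v' g4)
    have e3 := (abs_le.1 (hg z z' i)).2
    linarith
  -- characterization of F2
  have hchar : ∀ x q, (∀ u, q ∈ G x u) →
      (∀ z i, a z i - lam2 * ρ x z ≤ q i ∧ q i ≤ b z i + lam2 * ρ x z) → q ∈ F2 x := by
    intro x q hq hbox
    rw [hF2']
    intro z
    let A : Fin 2 → ℝ := fun i => q i - lam2 * ρ x z
    let B : Fin 2 → ℝ := fun i => q i + lam2 * ρ x z
    have hmeet : ∀ u, ∃ p ∈ G z u, ∀ i, A i ≤ p i ∧ p i ≤ B i := by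
      intro u
      obtain ⟨w, hw, hqw⟩ := (hG x u q).1 (hq u)
      have : ∀ i, ∃ p, |p - w i| ≤ lam1 * ρ z u ∧ A i ≤ p ∧ p ≤ B i := by
        intro i
        have h1 := abs_le.1 (hqw i)
        have h2 := m1 (hρ_tri x z u)
        have h3 := h0 x z
        have h4 : lam1 * ρ x z ≤ lam2 * ρ x z := mul_le_mul_of_nonneg_right (by linarith) h3
        have h5 := hr2 x z
        exact aux_clamp _ _ _ _ (hr1 z u) (by simp only [A, B]; linarith)
          (by simp only [A]; linarith) (by simp only [B]; linarith)
      choose p hp hp' using this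
      exact ⟨p, (hG z u p).2 ⟨w, hw, hp⟩, hp'⟩
    obtain ⟨p, hp, hp'⟩ := aux_hellyD (G z) (hGc z) (hGk z) (trip z)
      {p : Fin 2 → ℝ | ∀ i, A i ≤ p i ∧ p i ≤ B i} (aux_Icc_convex A B) (aux_Icc_closed A B) ⟨z⟩ (by
        intro u v
        obtain ⟨p, hp, hpb⟩ := hmeet u
        obtain ⟨p', hp', hpb'⟩ := hmeet v
        refine aux_corner (hGc z u) (hGc z v) p hp hpb p' hp' hpb' (fun i => ?_)
        have h1 := hbox z i
        have h5 := hr2 x z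
        obtain ⟨d, hd, hd'⟩ := hex z i (A i) (B i) (by simp only [A, B]; linarith)
          (by simp only [B]; linarith) (by simp only [A]; linarith)
        exact ⟨d, (hF1' z d).1 hd u, (hF1' z d).1 hd v, hd'⟩)
    refine ⟨p, (hF1' z p).2 hp', fun i => ?_⟩
    have : q i - lam2 * ρ x z ≤ p i ∧ p i ≤ q i + lam2 * ρ x z := hp i
    exact abs_le.2 ⟨by linarith, by linarith⟩
  -- common facts on the boxes
  have hlohi : ∀ x z z' i, a z i - lam2 * ρ x z ≤ b z' i + lam2 * ρ x z' := by
    intro x z z' i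
    have h1 := hclose z z' i
    have h2 := hρ_tri z x z'
    rw [hρ_symm z x] at h2
    nlinarith [h0 x z, h0 x z']
  have hproj : ∀ x z i, ∃ q, (∀ u, q ∈ G x u) ∧ a z i - lam2 * ρ x z ≤ q i ∧
      q i ≤ b z i + lam2 * ρ x z := by
    intro x z i
    have h1 := hlohi x x z i
    have h2 := hlohi x z x i
    rw [hρ_refl, mul_zero] at h1 h2
    obtain ⟨q, hq, h⟩ := hex x i _ _ (hlohi x z z i) (by linarith) (by linarith)
    exact ⟨q, (hF1' x q).1 hq, h⟩
  have hzz : ∀ x u z z' (i j : Fin 2), ρ x z ≤ ρ x z' → ∃ w ∈ F u,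
      (a z i - lam2 * ρ x z - lam1 * ρ x u ≤ w i ∧ w i ≤ b z i + lam2 * ρ x z + lam1 * ρ x u) ∧
      (a z' j - lam2 * ρ x z' - lam1 * ρ x u ≤ w j ∧
        w j ≤ b z' j + lam2 * ρ x z' + lam1 * ρ x u) := by
    intro x u z z' i j hle
    have c1 := hclose z z' j
    have c2 := hclose z' z j
    rw [hρ_symm z' z] at c2
    obtain ⟨p, hp, hp1, hp2⟩ := hex z j (a z' j - ρ z z') (b z' j + ρ z z')
      (by linarith [hab z' j, h0 z z']) c1 (by linarith)
    obtain ⟨w, hw, hpw⟩ := (hG z u p).1 ((hF1' z p).1 hp u)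
    have t1 := hρ_tri z x z'
    have t2 := hρ_tri z x u
    rw [hρ_symm z x] at t1 t2
    have t3 := m1 t2
    have e1 := abs_le.1 (hpw i)
    have e2 := abs_le.1 (hpw j)
    have e3 := hin z p hp i
    have n1 : lam1 * ρ x z ≤ lam2 * ρ x z := mul_le_mul_of_nonneg_right (by linarith) (h0 x z)
    have n2 : ρ z z' + lam1 * ρ x z ≤ lam2 * ρ x z' := by
      have k1 := m1 hle
      have k2 := mul_le_mul_of_nonneg_right hlam2 (h0 x z')
      have k3 := mul_le_mul_of_nonneg_right hlam1 (h0 x z')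
      linarith
    refine ⟨w, hw, ⟨?_, ?_⟩, ⟨?_, ?_⟩⟩ <;> linarith
  have hpt : ∀ x u (lo hi : Fin 2 → ℝ), (∀ i, lo i ≤ hi i) → (∃ w ∈ F u, ∀ i,
      lo i - lam1 * ρ x u ≤ w i ∧ w i ≤ hi i + lam1 * ρ x u) →
      ∃ q ∈ G x u, ∀ i, lo i ≤ q i ∧ q i ≤ hi i := by
    rintro x u lo hi hlh ⟨w, hw, h⟩
    choose q hq hq' using fun i => aux_clamp _ _ _ _ (hr1 x u) (hlh i) (h i).1 (h i).2
    exact ⟨q, (hG x u q).2 ⟨w, hw, hq⟩, hq'⟩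
  have F2ne : ∀ x, (F2 x).Nonempty := by
    intro x
    haveI : Nonempty M := ⟨x⟩
    obtain ⟨q, hq, hq'⟩ := aux_general (G x) (hGc x) (hGk x)
      (fun z i => a z i - lam2 * ρ x z) (fun z i => b z i + lam2 * ρ x z) (trip x)
      (hlohi x) (by
        intro u k
        refine hpt x u (fun i => a (k i) i - lam2 * ρ x (k i)) (fun i => b (k i) i + lam2 * ρ x (k i))
          (fun i => hlohi x _ _ i) ?_
        rcases le_total (ρ x (k 0)) (ρ x (k 1)) with h | h
        · obtain ⟨w, hw, h1, h2⟩ := hzz x u _ _ 0 1 h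
          exact ⟨w, hw, Fin.forall_fin_two.2 ⟨h1, h2⟩⟩
        · obtain ⟨w, hw, h1, h2⟩ := hzz x u _ _ 1 0 h
          exact ⟨w, hw, Fin.forall_fin_two.2 ⟨h2, h1⟩⟩) (hproj x)
    exact ⟨q, hchar x q hq hq'⟩
  refine ⟨F2ne, ?_⟩
  have main : ∀ x y, ∀ p ∈ F2 y, ∃ q ∈ F2 x, ∀ i, |p i - q i| ≤ γ * ρ x y := by
    intro x y p hp
    haveI : Nonempty M := ⟨x⟩
    have hp2 := (hF2' y p).1 hp
    have hp1 : p ∈ F1 y := by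
      obtain ⟨w, hw, h⟩ := hp2 y
      have : p = w := by
        ext i
        have := h i
        rw [hρ_refl, mul_zero] at this
        have := abs_nonpos_iff.1 this
        linarith
      rw [this]; exact hw
    have hR : lam2 * ρ x y ≤ γ * ρ x y := mul_le_mul_of_nonneg_right hγ2 (h0 x y)
    have hR0 : 0 ≤ γ * ρ x y := (hr2 x y).trans hR
    have hpz : ∀ z i, a z i - lam2 * ρ y z ≤ p i ∧ p i ≤ b z i + lam2 * ρ y z := by
      intro z i
      obtain ⟨w, hw, h⟩ := hp2 z
      have h1 := abs_le.1 (h i)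
      have h2 := hin z w hw i
      constructor <;> linarith
    have tri : ∀ z, ρ y z ≤ ρ x z + ρ x y := by
      intro z
      have := hρ_tri y x z
      rw [hρ_symm y x] at this
      linarith
    let lo : Option M → Fin 2 → ℝ := fun k => k.elim (fun i => p i - γ * ρ x y)
      (fun z i => a z i - lam2 * ρ x z)
    let hi : Option M → Fin 2 → ℝ := fun k => k.elim (fun i => p i + γ * ρ x y)
      (fun z i => b z i + lam2 * ρ x z)
    have hlh : ∀ k k' i, lo k i ≤ hi k' i := by
      rintro (_ | z) (_ | z') i
      · simp only [lo, hi, Option.elim]; linarith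
      · simp only [lo, hi, Option.elim]
        have h1 := hpz z' i
        have h2 := m2 (tri z')
        linarith
      · simp only [lo, hi, Option.elim]
        have h1 := hpz z i
        have h2 := m2 (tri z)
        linarith
      · exact hlohi x z z' i
    have hmixed : ∀ u z (i j : Fin 2), ∃ w ∈ F u,
        (p i - γ * ρ x y - lam1 * ρ x u ≤ w i ∧ w i ≤ p i + γ * ρ x y + lam1 * ρ x u) ∧
        (a z j - lam2 * ρ x z - lam1 * ρ x u ≤ w j ∧ w j ≤ b z j + lam2 * ρ x z + lam1 * ρ x u) := by
      intro u z i j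
      obtain ⟨t, ht0, ht1, hc1, hc2⟩ := aux_mix (ρ x y) (ρ x z) (ρ x u) lam1 lam2 γ (h0 x y) (h0 x z)
        hlam1 hlam2 hγ' hγ2
      obtain ⟨qa, hqa, hqa'⟩ := (hG y u p).1 ((hF1' y p).1 hp1 u)
      obtain ⟨p', hp', hpp⟩ := hp2 z
      obtain ⟨qb, hqb, hqb'⟩ := (hG z u p').1 ((hF1' z p').1 hp' u)
      have t1 := m1 (tri u)
      have t2 := m2 (tri z)
      have t3 : lam1 * ρ z u ≤ lam1 * (ρ x z + ρ x u) := by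
        have := hρ_tri z x u
        rw [hρ_symm z x] at this
        exact m1 this
      have s0 : 0 ≤ 1 - t := by linarith
      have cmb : ∀ {c d c' d' : ℝ}, c ≤ c' → d ≤ d' → (1 - t) * c + t * d ≤ (1 - t) * c' + t * d' :=
        fun h h' => add_le_add (mul_le_mul_of_nonneg_left h s0) (mul_le_mul_of_nonneg_left h' ht0)
      have ai := abs_le.1 (hqa' i)
      have aj := abs_le.1 (hqa' j)
      have bi := abs_le.1 (hqb' i)
      have bj := abs_le.1 (hqb' j)
      have pi' := abs_le.1 (hpp i)
      have pz := hpz z j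
      have pj := hin z p' hp' j
      refine ⟨(1 - t) • qa + t • qb, hFcv u hqa hqb s0 ht0 (by ring), ?_⟩
      simp only [Pi.add_apply, Pi.smul_apply, smul_eq_mul]
      refine ⟨⟨?_, ?_⟩, ⟨?_, ?_⟩⟩
      · have := cmb (c := p i - qa i) (d := p i - qb i)
          (c' := lam1 * (ρ x y + ρ x u)) (d' := lam2 * (ρ x z + ρ x y) + lam1 * (ρ x z + ρ x u))
          (by linarith) (by linarith)
        linarith
      · have := cmb (c := qa i - p i) (d := qb i - p i)
          (c' := lam1 * (ρ x y + ρ x u)) (d' := lam2 * (ρ x z + ρ x y) + lam1 * (ρ x z + ρ x u))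
          (by linarith) (by linarith)
        linarith
      · have := cmb (c := a z j - qa j) (d := a z j - qb j)
          (c' := lam2 * (ρ x z + ρ x y) + lam1 * (ρ x y + ρ x u)) (d' := lam1 * (ρ x z + ρ x u))
          (by linarith) (by linarith)
        linarith
      · have := cmb (c := qa j - b z j) (d := qb j - b z j)
          (c' := lam2 * (ρ x z + ρ x y) + lam1 * (ρ x y + ρ x u)) (d' := lam1 * (ρ x z + ρ x u))
          (by linarith) (by linarith)
        linarith
    obtain ⟨q, hq, hq'⟩ := aux_general (G x) (hGc x) (hGk x) lo hi (trip x) hlh (by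
        intro u k
        refine hpt x u (fun i => lo (k i) i) (fun i => hi (k i) i) (fun i => hlh _ _ i) ?_
        simp only [Fin.forall_fin_two]
        generalize k 0 = k0
        generalize k 1 = k1
        rcases k0 with _ | z <;> rcases k1 with _ | z' <;> simp only [lo, hi, Option.elim]
        · obtain ⟨w, hw, hpw⟩ := (hG y u p).1 ((hF1' y p).1 hp1 u)
          have t1 := m1 (tri u)
          have n1 : lam1 * ρ x y ≤ lam2 * ρ x y :=
            mul_le_mul_of_nonneg_right (by linarith) (h0 x y)
          have e1 := abs_le.1 (hpw 0)
          have e2 := abs_le.1 (hpw 1)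
          refine ⟨w, hw, ⟨?_, ?_⟩, ⟨?_, ?_⟩⟩ <;> linarith
        · exact hmixed u z' 0 1
        · obtain ⟨w, hw, h1, h2⟩ := hmixed u z 1 0
          exact ⟨w, hw, h2, h1⟩
        · rcases le_total (ρ x z) (ρ x z') with h | h
          · exact hzz x u _ _ 0 1 h
          · obtain ⟨w, hw, h1, h2⟩ := hzz x u _ _ 1 0 h
            exact ⟨w, hw, h2, h1⟩) (by
        rintro (_ | z) i
        · obtain ⟨w, hw, h⟩ := hp2 x
          refine ⟨w, (hF1' x w).1 hw, ?_⟩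
          have e := abs_le.1 (h i)
          rw [hρ_symm y x] at e
          simp only [lo, hi, Option.elim]
          constructor <;> linarith
        · exact hproj x z i)
    refine ⟨q, hchar x q hq (fun z i => hq' (some z) i), fun i => ?_⟩
    have := hq' none i
    simp only [lo, hi, Option.elim] at this
    exact abs_le.2 ⟨by linarith, by linarith⟩
  intro x y
  apply le_of_forall_pos_le_add
  intro ε hε
  have hR0 : 0 ≤ γ * ρ x y := mul_nonneg (by linarith) (h0 x y)
  refine csInf_le ⟨0, fun r hr => hr.1.le⟩ ⟨by linarith, ?_, ?_⟩
  · intro p hp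
    rw [aux_mem (by linarith)]
    obtain ⟨q, hq, h⟩ := main y x p hp
    rw [hρ_symm y x] at h
    exact ⟨q, hq, fun i => (h i).trans (by linarith)⟩
  · intro p hp
    rw [aux_mem (by linarith)]
    obtain ⟨q, hq, h⟩ := main x y p hp
    exact ⟨q, hq, fun i => (h i).trans (by linarith)⟩
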